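/- arXiv:0912.0494 — 6 statements merged into one kernel-verified Lean document; each statement's English description precedes it below -/
import Mathlib

section
/- Let a, b be integers with b ≥ a + 2 and let g : ℤ → ℝ. If Σ_{t=a}^{b-1} g(t)·(η(t+1) − η(t)) = 0 for every function η : ℤ → ℝ with η(a) = η(b) = 0, then there exists a constant c ∈ ℝ such that g(t) = c for all integers t with a ≤ t ≤ b − 1. (This is the delta Dubois-Reymond lemma of the paper on the time scale T = ℤ.) -/
/-- The delta Dubois-Reymond lemma on the time scale `T = ℤ`:
if `Σ_{t=a}^{b-1} g(t)·(η(t+1) − η(t)) = 0` for every `η : ℤ → ℝ` with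
`η(a) = η(b) = 0`, then `g` is constant on `{a, …, b−1}`. -/
theorem duboisReymond_delta_int (a b : ℤ) (hab : a + 2 ≤ b) (g : ℤ → ℝ)
    (h : ∀ η : ℤ → ℝ, η a = 0 → η b = 0 →
      ∑ t ∈ Finset.Icc a (b - 1), g t * (η (t + 1) - η t) = 0) :
    ∃ c : ℝ, ∀ t ∈ Finset.Icc a (b - 1), g t = c := by
  refine ⟨g a, fun s hs => ?_⟩
  rw [Finset.mem_Icc] at hs
  have h1 := h (fun x => if a < x ∧ x ≤ s then 1 else 0) (by simp) (by
    rw [if_neg]; omega)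
  have h2 : ∀ t ∈ Finset.Icc a (b - 1),
      g t * ((if a < t + 1 ∧ t + 1 ≤ s then (1 : ℝ) else 0) - (if a < t ∧ t ≤ s then 1 else 0))
        = (if t = a then g t else 0) - (if t = s then g t else 0) := by
    intro t ht
    rw [Finset.mem_Icc] at ht
    split_ifs <;> first | (exfalso; omega) | ring
  rw [Finset.sum_congr rfl h2, Finset.sum_sub_distrib, Finset.sum_ite_eq', Finset.sum_ite_eq',
    if_pos (Finset.mem_Icc.2 ⟨le_refl a, by omega⟩), if_pos (Finset.mem_Icc.2 hs)] at h1
  linarith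
end

section
/- Let a, b be integers with b ≥ a + 2 and let f : ℤ → ℝ. If Σ_{t=a+1}^{b} f(t)·(η(t) − η(t−1)) = 0 for every function η : ℤ → ℝ with η(a) = η(b) = 0, then there exists a constant c ∈ ℝ such that f(t) = c for all integers t with a + 1 ≤ t ≤ b. (This is the nabla Dubois-Reymond lemma of the paper on the time scale T = ℤ.) -/
/-- The nabla Dubois-Reymond lemma on the time scale `T = ℤ`:
if `Σ_{t=a+1}^{b} f(t)·(η(t) − η(t−1)) = 0` for every `η : ℤ → ℝ` with
`η(a) = η(b) = 0`, then `f` is constant on `{a+1, …, b}`. -/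
theorem duboisReymond_nabla_int (a b : ℤ) (hab : a + 2 ≤ b) (f : ℤ → ℝ)
    (h : ∀ η : ℤ → ℝ, η a = 0 → η b = 0 →
      ∑ t ∈ Finset.Icc (a + 1) b, f t * (η t - η (t - 1)) = 0) :
    ∃ c : ℝ, ∀ t ∈ Finset.Icc (a + 1) b, f t = c := by
  have step : ∀ s : ℤ, a + 1 ≤ s → s + 1 ≤ b → f (s + 1) = f s := by
    intro s h1 h2
    have key := h (fun t => if t = s then 1 else 0)
      (if_neg (by omega)) (if_neg (by omega))
    have e : ∀ t : ℤ, (t - 1 = s) = (t = s + 1) := fun t => propext (by omega)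
    simp only [e, mul_sub, mul_ite, mul_one, mul_zero, Finset.sum_sub_distrib,
      Finset.sum_ite_eq'] at key
    rw [if_pos (Finset.mem_Icc.2 ⟨h1, by omega⟩),
      if_pos (Finset.mem_Icc.2 ⟨by omega, h2⟩)] at key
    linarith
  refine ⟨f (a + 1), fun t ht => ?_⟩
  obtain ⟨h1, h2⟩ := Finset.mem_Icc.1 ht
  clear ht
  induction t, h1 using Int.le_induction with
  | base => rfl
  | succ n hn ih => rw [step n hn h2, ih (by omega)]
end

section
/- Let a < b be real numbers, α, β ∈ ℝ, and let L₁, L₂ : ℝ × ℝ × ℝ → ℝ be continuously differentiable. If ŷ is a weak local extremizer of J(y) = J₁(y)·J₂(y) subject to y(a) = α, y(b) = β, then there exists a constant c ∈ ℝ such that for all t ∈ [a,b]: J₂(ŷ)·(∂₃L₁(t, ŷ(t), ŷ'(t)) − ∫_a^t ∂₂L₁(τ, ŷ(τ), ŷ'(τ)) dτ) + J₁(ŷ)·(∂₃L₂(t, ŷ(t), ŷ'(t)) − ∫_a^t ∂₂L₂(τ, ŷ(τ), ŷ'(τ)) dτ) = c. (This is the paper's general Euler-Lagrange equation for the product functional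 in the case T = ℝ, where equations (EL1) and (EL2) coincide.) -/
/-- The integral functional `J(y) = ∫ₐᵇ L(t, y(t), y'(t)) dt`. -/
noncomputable def varFunctional (a b : ℝ) (L : ℝ × ℝ × ℝ → ℝ) (y : ℝ → ℝ) : ℝ :=
  ∫ t in a..b, L (t, y t, deriv y t)

/-- Partial derivative of `L` with respect to its second argument. -/
noncomputable def partial2 (L : ℝ × ℝ × ℝ → ℝ) (t u v : ℝ) : ℝ :=
  deriv (fun z => L (t, z, v)) u

/-- Partial derivative of `L` with respect to its third argument. -/
noncomputable def partial3 (L : ℝ × ℝ × ℝ → ℝ) (t u v : ℝ) : ℝ :=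
  deriv (fun z => L (t, u, z)) v

/-- `y` is admissible: continuously differentiable with the given boundary values. -/
def Admissible (a b α β : ℝ) (y : ℝ → ℝ) : Prop :=
  ContDiff ℝ 1 y ∧ y a = α ∧ y b = β

/-- The weak distance `‖y − z‖₁,∞` on `[a, b]`:
`sup_{t∈[a,b]} |y(t) − z(t)| + sup_{t∈[a,b]} |y'(t) − z'(t)|`. -/
noncomputable def weakDist (a b : ℝ) (y z : ℝ → ℝ) : ℝ :=
  (⨆ t ∈ Set.Icc a b, |y t - z t|) + (⨆ t ∈ Set.Icc a b, |deriv y t - deriv z t|)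

/-- `yhat` is a weak local extremizer (minimizer or maximizer) of the functional `F`
among admissible functions. -/
def IsWeakLocalExtremizer (a b α β : ℝ) (F : (ℝ → ℝ) → ℝ) (yhat : ℝ → ℝ) : Prop :=
  Admissible a b α β yhat ∧ ∃ δ > 0,
    (∀ y : ℝ → ℝ, Admissible a b α β y → weakDist a b y yhat < δ → F yhat ≤ F y) ∨
    (∀ y : ℝ → ℝ, Admissible a b α β y → weakDist a b y yhat < δ → F y ≤ F yhat)

theorem partial2_eq (L : ℝ × ℝ × ℝ → ℝ) (hL : ContDiff ℝ 1 L) (t u v : ℝ) :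
    partial2 L t u v = fderiv ℝ L (t, u, v) (0, 1, 0) := by
  have h1 : HasFDerivAt L (fderiv ℝ L (t, u, v)) (t, u, v) :=
    (hL.differentiable one_ne_zero _).hasFDerivAt
  have h2 : HasDerivAt (fun z : ℝ => ((t, z, v) : ℝ × ℝ × ℝ)) (0, 1, 0) u :=
    (hasDerivAt_const u t).prodMk ((hasDerivAt_id u).prodMk (hasDerivAt_const u v))
  exact (h1.comp_hasDerivAt u h2).deriv

theorem partial3_eq (L : ℝ × ℝ × ℝ → ℝ) (hL : ContDiff ℝ 1 L) (t u v : ℝ) :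
    partial3 L t u v = fderiv ℝ L (t, u, v) (0, 0, 1) := by
  have h1 : HasFDerivAt L (fderiv ℝ L (t, u, v)) (t, u, v) :=
    (hL.differentiable one_ne_zero _).hasFDerivAt
  have h2 : HasDerivAt (fun z : ℝ => ((t, u, z) : ℝ × ℝ × ℝ)) (0, 0, 1) v :=
    (hasDerivAt_const v t).prodMk ((hasDerivAt_const v u).prodMk (hasDerivAt_id v))
  exact (h1.comp_hasDerivAt v h2).deriv

theorem partial2_cont (L : ℝ × ℝ × ℝ → ℝ) (hL : ContDiff ℝ 1 L) (y y' : ℝ → ℝ)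
    (hy : Continuous y) (hy' : Continuous y') :
    Continuous (fun t => partial2 L t (y t) (y' t)) := by
  simp only [partial2_eq L hL]
  have := hL.continuous_fderiv one_ne_zero
  fun_prop

theorem partial3_cont (L : ℝ × ℝ × ℝ → ℝ) (hL : ContDiff ℝ 1 L) (y y' : ℝ → ℝ)
    (hy : Continuous y) (hy' : Continuous y') :
    Continuous (fun t => partial3 L t (y t) (y' t)) := by
  simp only [partial3_eq L hL]
  have := hL.continuous_fderiv one_ne_zero
  fun_prop

theorem first_variation (a b : ℝ) (L : ℝ × ℝ × ℝ → ℝ) (hL : ContDiff ℝ 1 L)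
    (y y' n n' : ℝ → ℝ) (hy : Continuous y) (hy' : Continuous y')
    (hn : Continuous n) (hn' : Continuous n') :
    HasDerivAt (fun e : ℝ => ∫ t in a..b, L (t, y t + e * n t, y' t + e * n' t))
      (∫ t in a..b, (partial2 L t (y t) (y' t) * n t + partial3 L t (y t) (y' t) * n' t)) 0 := by
  have hfd := hL.continuous_fderiv one_ne_zero
  have hLc := hL.continuous
  let F' : ℝ → ℝ → ℝ := fun e t =>
    fderiv ℝ L (t, y t + e * n t, y' t + e * n' t) (0, n t, n' t)
  have hF'c : Continuous (fun p : ℝ × ℝ => F' p.1 p.2) := by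
    simp only [F']
    fun_prop
  obtain ⟨C, hC⟩ := ((isCompact_Icc (a := (-1 : ℝ)) (b := 1)).prod
    (isCompact_uIcc (a := a) (b := b))).exists_bound_of_continuousOn hF'c.continuousOn
  have key := intervalIntegral.hasDerivAt_integral_of_dominated_loc_of_deriv_le
    (μ := MeasureTheory.volume) (a := a) (b := b) (x₀ := (0 : ℝ)) (s := Set.Icc (-1) 1)
    (F := fun e t => L (t, y t + e * n t, y' t + e * n' t)) (F' := F') (bound := fun _ => C)
    (Icc_mem_nhds (by norm_num) (by norm_num))
    (Filter.Eventually.of_forall fun e =>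
      (by fun_prop : Continuous fun t => L (t, y t + e * n t, y' t + e * n' t)).aestronglyMeasurable)
    ((by fun_prop : Continuous fun t =>
      L (t, y t + (0 : ℝ) * n t, y' t + (0 : ℝ) * n' t)).intervalIntegrable _ _)
    ((hF'c.comp (by fun_prop : Continuous fun t : ℝ => ((0 : ℝ), t))).aestronglyMeasurable)
    (Filter.Eventually.of_forall fun t ht e he =>
      hC (e, t) ⟨he, Set.uIoc_subset_uIcc ht⟩)
    (continuous_const.intervalIntegrable _ _)
    (Filter.Eventually.of_forall fun t _ e _ => by
      have h1 : HasFDerivAt L (fderiv ℝ L (t, y t + e * n t, y' t + e * n' t))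
          (t, y t + e * n t, y' t + e * n' t) :=
        (hL.differentiable one_ne_zero _).hasFDerivAt
      have h2 : HasDerivAt (fun e : ℝ => ((t, y t + e * n t, y' t + e * n' t) : ℝ × ℝ × ℝ))
          (0, n t, n' t) e := by
        refine (hasDerivAt_const e t).prodMk (HasDerivAt.prodMk ?_ ?_)
        · simpa using ((hasDerivAt_id e).mul_const (n t)).const_add (y t)
        · simpa using ((hasDerivAt_id e).mul_const (n' t)).const_add (y' t)
      exact h1.comp_hasDerivAt e h2)
  suffices hE : (∫ t in a..b, (partial2 L t (y t) (y' t) * n t + partial3 L t (y t) (y' t) * n' t))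
      = ∫ t in a..b, F' 0 t by
    rw [hE]
    exact key.2
  refine intervalIntegral.integral_congr fun t _ => ?_
  simp only [F', partial2_eq L hL, partial3_eq L hL, zero_mul, add_zero]
  have : ((0, n t, n' t) : ℝ × ℝ × ℝ) =
      n t • ((0, 1, 0) : ℝ × ℝ × ℝ) + n' t • ((0, 0, 1) : ℝ × ℝ × ℝ) := by
    simp
  rw [this, map_add, map_smul, map_smul]
  simp only [smul_eq_mul]
  ring

theorem weakDist_variation (a b : ℝ) (y n n' : ℝ → ℝ) (hy : Differentiable ℝ y)
    (hn : ∀ t, HasDerivAt n (n' t) t) (hn' : Continuous n') :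
    ∃ M : ℝ, 0 < M ∧ ∀ e : ℝ, weakDist a b (fun t => y t + e * n t) y ≤ |e| * M := by
  have hnc : Continuous n := continuous_iff_continuousAt.2 fun t => (hn t).continuousAt
  obtain ⟨C, hC⟩ := (isCompact_Icc (a := a) (b := b)).exists_bound_of_continuousOn hnc.continuousOn
  obtain ⟨D, hD⟩ := (isCompact_Icc (a := a) (b := b)).exists_bound_of_continuousOn hn'.continuousOn
  refine ⟨|C| + |D| + 1, by positivity, fun e => ?_⟩
  have hd : ∀ t, deriv (fun t => y t + e * n t) t = deriv y t + e * n' t := fun t =>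
    ((hy t).hasDerivAt.add ((hn t).const_mul e)).deriv
  have h1 : (⨆ t ∈ Set.Icc a b, |(y t + e * n t) - y t|) ≤ |e| * |C| := by
    refine Real.iSup_le (fun t => Real.iSup_le (fun ht => ?_) (by positivity)) (by positivity)
    rw [add_sub_cancel_left, abs_mul]
    exact mul_le_mul_of_nonneg_left ((hC t ht).trans (le_abs_self _)) (abs_nonneg _)
  have h2 : (⨆ t ∈ Set.Icc a b, |deriv (fun t => y t + e * n t) t - deriv y t|) ≤ |e| * |D| := by
    refine Real.iSup_le (fun t => Real.iSup_le (fun ht => ?_) (by positivity)) (by positivity)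
    rw [hd, add_sub_cancel_left, abs_mul]
    exact mul_le_mul_of_nonneg_left ((hD t ht).trans (le_abs_self _)) (abs_nonneg _)
  unfold weakDist
  nlinarith [abs_nonneg e]

/-- The first variation vanishes. -/
theorem product_variation (a b α β : ℝ)
    (L₁ L₂ : ℝ × ℝ × ℝ → ℝ) (hL₁ : ContDiff ℝ 1 L₁) (hL₂ : ContDiff ℝ 1 L₂)
    (yhat : ℝ → ℝ)
    (hext : IsWeakLocalExtremizer a b α β
      (fun y => varFunctional a b L₁ y * varFunctional a b L₂ y) yhat)
    (n n' : ℝ → ℝ) (hn : ∀ t, HasDerivAt n (n' t) t) (hn' : Continuous n')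
    (ha : n a = 0) (hb : n b = 0) :
    (∫ t in a..b, (partial2 L₁ t (yhat t) (deriv yhat t) * n t
        + partial3 L₁ t (yhat t) (deriv yhat t) * n' t)) * varFunctional a b L₂ yhat +
    varFunctional a b L₁ yhat * (∫ t in a..b, (partial2 L₂ t (yhat t) (deriv yhat t) * n t
        + partial3 L₂ t (yhat t) (deriv yhat t) * n' t)) = 0 := by
  obtain ⟨⟨hy, hya, hyb⟩, δ, hδ, hmin⟩ := hext
  have hyd : Differentiable ℝ yhat := hy.differentiable one_ne_zero
  have hyc' : Continuous (deriv yhat) := hy.continuous_deriv le_rfl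
  have hnd : deriv n = n' := funext fun t => (hn t).deriv
  have hnC : ContDiff ℝ 1 n :=
    contDiff_one_iff_deriv.2 ⟨fun t => (hn t).differentiableAt, hnd ▸ hn'⟩
  have hd : ∀ e t, deriv (fun t => yhat t + e * n t) t = deriv yhat t + e * n' t := fun e t =>
    ((hyd t).hasDerivAt.add ((hn t).const_mul e)).deriv
  have hadm : ∀ e, Admissible a b α β (fun t => yhat t + e * n t) := fun e =>
    ⟨hy.add (contDiff_const.mul hnC), by simp [ha, hya], by simp [hb, hyb]⟩
  obtain ⟨M, hM, hdist⟩ := weakDist_variation a b yhat n n' hyd hn hn'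
  have h0 : (fun t => yhat t + (0 : ℝ) * n t) = yhat := by ext; simp
  have hv : ∀ L : ℝ × ℝ × ℝ → ℝ, ∀ hL : ContDiff ℝ 1 L,
      HasDerivAt (fun e : ℝ => varFunctional a b L (fun t => yhat t + e * n t))
      (∫ t in a..b, (partial2 L t (yhat t) (deriv yhat t) * n t
        + partial3 L t (yhat t) (deriv yhat t) * n' t)) 0 := by
    intro L hL
    simp only [varFunctional, hd]
    exact first_variation a b L hL yhat (deriv yhat) n n' hy.continuous hyc' hnC.continuous hn'
  have hprod := (hv L₁ hL₁).mul (hv L₂ hL₂)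
  simp only [h0] at hprod
  have hev : ∀ᶠ e in nhds (0 : ℝ), weakDist a b (fun t => yhat t + e * n t) yhat < δ := by
    filter_upwards [Metric.ball_mem_nhds (0 : ℝ) (div_pos hδ hM)] with e he
    rw [Metric.mem_ball, Real.dist_eq, sub_zero, lt_div_iff₀ hM] at he
    exact (hdist e).trans_lt he
  refine IsLocalExtr.hasDerivAt_eq_zero ?_ hprod
  rcases hmin with hmin | hmax
  · left
    filter_upwards [hev] with e he
    simpa [h0] using hmin _ (hadm e) he
  · right
    filter_upwards [hev] with e he
    simpa [h0] using hmax _ (hadm e) he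

theorem variation_by_parts (a b : ℝ) (g h n n' : ℝ → ℝ) (hg : Continuous g) (hh : Continuous h)
    (hn : ∀ t, HasDerivAt n (n' t) t) (hn' : Continuous n') (hb : n b = 0) :
    ∫ t in a..b, (g t * n t + h t * n' t) =
      ∫ t in a..b, (h t - ∫ s in a..t, g s) * n' t := by
  have hnc : Continuous n := continuous_iff_continuousAt.2 fun t => (hn t).continuousAt
  have hG : ∀ t, HasDerivAt (fun t => ∫ s in a..t, g s) (g t) t := fun t =>
    intervalIntegral.integral_hasDerivAt_right (hg.intervalIntegrable _ _)
      hg.aestronglyMeasurable.stronglyMeasurableAtFilter hg.continuousAt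
  have hGc : Continuous (fun t => ∫ s in a..t, g s) :=
    continuous_iff_continuousAt.2 fun t => (hG t).continuousAt
  have hp := intervalIntegral.integral_mul_deriv_eq_deriv_mul (a := a) (b := b)
    (fun t _ => hG t) (fun t _ => hn t)
    (hg.intervalIntegrable _ _) (hn'.intervalIntegrable _ _)
  simp only [hb, intervalIntegral.integral_same, mul_zero, zero_mul, sub_zero, zero_sub] at hp
  simp only [sub_mul]
  have e1 : IntervalIntegrable (fun t => g t * n t) MeasureTheory.volume a b :=
    (hg.mul hnc).intervalIntegrable _ _
  have e2 : IntervalIntegrable (fun t => h t * n' t) MeasureTheory.volume a b :=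
    (hh.mul hn').intervalIntegrable _ _
  have e3 : IntervalIntegrable (fun t => (∫ s in a..t, g s) * n' t) MeasureTheory.volume a b :=
    (hGc.mul hn').intervalIntegrable _ _
  rw [intervalIntegral.integral_add e1 e2, intervalIntegral.integral_sub e2 e3, hp]
  ring

/-- The general Euler-Lagrange equation for the product functional
`J(y) = J₁(y)·J₂(y)` in the case `T = ℝ`. -/
theorem eulerLagrange_product_real (a b α β : ℝ) (hab : a < b)
    (L₁ L₂ : ℝ × ℝ × ℝ → ℝ) (hL₁ : ContDiff ℝ 1 L₁) (hL₂ : ContDiff ℝ 1 L₂)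
    (yhat : ℝ → ℝ)
    (hext : IsWeakLocalExtremizer a b α β
      (fun y => varFunctional a b L₁ y * varFunctional a b L₂ y) yhat) :
    ∃ c : ℝ, ∀ t ∈ Set.Icc a b,
      varFunctional a b L₂ yhat *
        (partial3 L₁ t (yhat t) (deriv yhat t)
          - ∫ τ in a..t, partial2 L₁ τ (yhat τ) (deriv yhat τ)) +
      varFunctional a b L₁ yhat *
        (partial3 L₂ t (yhat t) (deriv yhat t)
          - ∫ τ in a..t, partial2 L₂ τ (yhat τ) (deriv yhat τ)) = c := by
  have hy := hext.1.1
  have hyc := hy.continuous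
  have hyc' : Continuous (deriv yhat) := hy.continuous_deriv le_rfl
  have hvar := product_variation a b α β L₁ L₂ hL₁ hL₂ yhat hext
  have hg1 := partial2_cont L₁ hL₁ _ _ hyc hyc'
  have hg2 := partial2_cont L₂ hL₂ _ _ hyc hyc'
  have hh1 := partial3_cont L₁ hL₁ _ _ hyc hyc'
  have hh2 := partial3_cont L₂ hL₂ _ _ hyc hyc'
  have hi1 := intervalIntegral.continuous_primitive (fun p q => hg1.intervalIntegrable (μ := MeasureTheory.volume) p q) a
  have hi2 := intervalIntegral.continuous_primitive (fun p q => hg2.intervalIntegrable (μ := MeasureTheory.volume) p q) a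
  have hk1 := hh1.sub hi1
  have hk2 := hh2.sub hi2
  set φ : ℝ → ℝ := fun t => varFunctional a b L₂ yhat *
        (partial3 L₁ t (yhat t) (deriv yhat t)
          - ∫ τ in a..t, partial2 L₁ τ (yhat τ) (deriv yhat τ)) +
      varFunctional a b L₁ yhat *
        (partial3 L₂ t (yhat t) (deriv yhat t)
          - ∫ τ in a..t, partial2 L₂ τ (yhat τ) (deriv yhat τ)) with hφ
  have hφc : Continuous φ := (continuous_const.mul hk1).add (continuous_const.mul hk2)
  set c : ℝ := (∫ t in a..b, φ t) / (b - a) with hc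
  have hψc : Continuous (fun t => φ t - c) := hφc.sub continuous_const
  have hn : ∀ t, HasDerivAt (fun t => ∫ s in a..t, (φ s - c)) (φ t - c) t := fun t =>
    intervalIntegral.integral_hasDerivAt_right (hψc.intervalIntegrable _ _)
      hψc.aestronglyMeasurable.stronglyMeasurableAtFilter hψc.continuousAt
  have hba : b - a ≠ 0 := sub_ne_zero.2 hab.ne'
  have hnb : ∫ s in a..b, (φ s - c) = 0 := by
    rw [intervalIntegral.integral_sub (hφc.intervalIntegrable _ _)
      (continuous_const.intervalIntegrable _ _), intervalIntegral.integral_const, hc, smul_eq_mul]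
    field_simp
    ring
  have hz := hvar _ _ hn hψc (by simp) hnb
  rw [variation_by_parts a b _ _ _ _ hg1 hh1 hn hψc hnb,
    variation_by_parts a b _ _ _ _ hg2 hh2 hn hψc hnb, mul_comm,
    ← intervalIntegral.integral_const_mul, ← intervalIntegral.integral_const_mul,
    ← intervalIntegral.integral_add
      (Continuous.intervalIntegrable (by exact continuous_const.mul (hk1.mul hψc)) _ _)
      (Continuous.intervalIntegrable (by exact continuous_const.mul (hk2.mul hψc)) _ _)] at hz
  have hz' : ∫ t in a..b, φ t * (φ t - c) = 0 := by
    rw [← hz]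
    congr 1
    ext t
    simp only [hφ]
    ring
  have hsq : ∫ t in a..b, (φ t - c) ^ 2 = 0 := by
    have : (fun t => (φ t - c) ^ 2) = fun t => φ t * (φ t - c) - c * (φ t - c) := by
      ext t; ring
    rw [this, intervalIntegral.integral_sub
      (Continuous.intervalIntegrable (by exact hφc.mul hψc) _ _)
      (Continuous.intervalIntegrable (by exact continuous_const.mul hψc) _ _), hz',
      intervalIntegral.integral_const_mul, hnb]
    simp
  refine ⟨c, fun t ht => ?_⟩
  change φ t = c
  by_contra hne
  have hlt := intervalIntegral.integral_lt_integral_of_continuousOn_of_le_of_exists_lt hab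
    (f := fun _ => (0 : ℝ)) (g := fun t => (φ t - c) ^ 2) continuousOn_const
    (hψc.pow 2).continuousOn (fun x _ => sq_nonneg _)
    ⟨t, ht, by have := sub_ne_zero.2 hne; positivity⟩
  rw [hsq] at hlt
  simp at hlt
end

section
/- Let N ≥ 2 be an integer. For every function y : ℤ → ℝ with y(0) = 0 and y(N) = N, one has (Σ_{t=0}^{N−1} (y(t+1) − y(t))²)·(Σ_{t=1}^{N} (y(t) − y(t−1))²) ≥ N², and equality holds for y(t) = t. In particular, y(t) = t is a global minimizer of the delta-nabla functional J(y) = (Σ_{t=0}^{N−1} (Δy(t))²)·(Σ_{t=1}^{N} (∇y(t))²) subject to y(0) = 0, y(N) = N. (This is the paper's Example on the time scale T = ℤ.) -/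
theorem sum_Icc_aux (a : ℤ) (n : ℕ) (f : ℤ → ℝ) :
    ∑ t ∈ Finset.Icc a (a + n - 1), f t = ∑ i ∈ Finset.range n, f (a + i) := by
  refine Finset.sum_nbij' (fun t => (t - a).toNat) (fun i => a + (i : ℤ)) ?_ ?_ ?_ ?_ ?_
  · intro t ht
    simp only [Finset.mem_Icc, Finset.mem_range] at *
    omega
  · intro t ht
    simp only [Finset.mem_Icc, Finset.mem_range] at *
    omega
  · intro t ht
    simp only [Finset.mem_Icc] at *
    omega
  · intro t ht
    simp
  · intro t ht
    simp only [Finset.mem_Icc] at ht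
    congr 1
    omega

theorem sum_lower_aux (n : ℕ) (y : ℤ → ℝ) :
    2 * (y n - y 0) - n ≤ ∑ i ∈ Finset.range n, (y ((i : ℤ) + 1) - y i) ^ 2 := by
  induction n with
  | zero => simp
  | succ k ih =>
    rw [Finset.sum_range_succ]
    push_cast
    nlinarith [sq_nonneg (y ((k : ℤ) + 1) - y k - 1)]

/-- The paper's example on `T = ℤ`: among `y : ℤ → ℝ` with `y(0) = 0`,
`y(N) = N`, the delta-nabla product functional
`J(y) = (Σ_{t=0}^{N−1} (Δy(t))²)·(Σ_{t=1}^{N} (∇y(t))²)` is at least `N²`,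
with equality for `y(t) = t`; hence `y(t) = t` is a global minimizer. -/
theorem example_int (N : ℤ) (hN : 2 ≤ N) :
    (∀ y : ℤ → ℝ, y 0 = 0 → y N = (N : ℝ) →
      (N : ℝ) ^ 2 ≤ (∑ t ∈ Finset.Icc (0:ℤ) (N - 1), (y (t + 1) - y t) ^ 2) *
        (∑ t ∈ Finset.Icc (1:ℤ) N, (y t - y (t - 1)) ^ 2)) ∧
    (∑ t ∈ Finset.Icc (0:ℤ) (N - 1), (((t + 1 : ℤ) : ℝ) - ((t : ℤ) : ℝ)) ^ 2) *
      (∑ t ∈ Finset.Icc (1:ℤ) N, (((t : ℤ) : ℝ) - ((t - 1 : ℤ) : ℝ)) ^ 2) = (N : ℝ) ^ 2 := by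
  obtain ⟨n, rfl⟩ := Int.eq_ofNat_of_zero_le (show 0 ≤ N by omega)
  have h0 : ∀ f : ℤ → ℝ, ∑ t ∈ Finset.Icc (0:ℤ) ((n : ℤ) - 1), f t
      = ∑ i ∈ Finset.range n, f i := by
    intro f
    simpa using sum_Icc_aux 0 n f
  have h1 : ∀ f : ℤ → ℝ, ∑ t ∈ Finset.Icc (1:ℤ) (n : ℤ), f t
      = ∑ i ∈ Finset.range n, f ((i : ℤ) + 1) := by
    intro f
    have h := sum_Icc_aux 1 n f
    rw [show (1 : ℤ) + n - 1 = n by ring] at h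
    rw [h]
    exact Finset.sum_congr rfl fun i _ => by rw [add_comm]
  constructor
  · intro y hy0 hyN
    rw [h0, h1]
    simp only [add_sub_cancel_right]
    have h := sum_lower_aux n y
    rw [hy0, hyN] at h
    push_cast at h ⊢
    have hn : (0 : ℝ) ≤ n := Nat.cast_nonneg n
    nlinarith
  · rw [h0, h1]
    simp [pow_two]
end

section
/- Let a < b be real numbers, let L₁, L₂ : ℝ × ℝ × ℝ → ℝ be continuously differentiable, and let ŷ, η : ℝ → ℝ be continuously differentiable on [a,b]. Then the function φ : ℝ → ℝ defined by φ(ε) = J(ŷ + ε·η) is differentiable at ε = 0 with φ'(0) = J₂(ŷ)·∫_a^b (∂₂L₁(t, ŷ(t), ŷ'(t))·η(t) + ∂₃L₁(t, ŷ(t), ŷ'(t))·η'(t)) dt + J₁(ŷ)·∫_a^b (∂₂L₂(t, ŷ(t), ŷ'(t))·η(t) + ∂₃L₂(t, ŷ(t), ŷ'(t))·η'(t)) dt. -/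
open Topology in
theorem hasDerivAt_varFunctional_aux (a b : ℝ)
    (L : ℝ × ℝ × ℝ → ℝ) (hL : ContDiff ℝ 1 L)
    (y η : ℝ → ℝ) (hy : ContDiff ℝ 1 y) (hη : ContDiff ℝ 1 η) :
    HasDerivAt (fun ε : ℝ => varFunctional a b L (fun t => y t + ε * η t))
      (∫ t in a..b, partial2 L t (y t) (deriv y t) * η t
          + partial3 L t (y t) (deriv y t) * deriv η t) 0 := by
  have hyc := hy.continuous
  have hηc := hη.continuous
  have hy' : Continuous (deriv y) := hy.continuous_deriv le_rfl
  have hη' : Continuous (deriv η) := hη.continuous_deriv le_rfl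
  have hLc := hL.continuous
  have hL' : Continuous (fderiv ℝ L) := hL.continuous_fderiv one_ne_zero
  have hLd : Differentiable ℝ L := hL.differentiable one_ne_zero
  have hyd : Differentiable ℝ y := hy.differentiable one_ne_zero
  have hηd : Differentiable ℝ η := hη.differentiable one_ne_zero
  have hd : ∀ ε t : ℝ, deriv (fun t => y t + ε * η t) t = deriv y t + ε * deriv η t := by
    intro ε t
    exact ((hyd t).hasDerivAt.add ((hηd t).hasDerivAt.const_mul ε)).deriv
  have h2 : ∀ t u v : ℝ, partial2 L t u v = fderiv ℝ L (t, u, v) (0, 1, 0) := by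
    intro t u v
    have h : HasDerivAt (fun z : ℝ => (t, z, v)) ((0 : ℝ), (1 : ℝ), (0 : ℝ)) u :=
      (hasDerivAt_const u t).prodMk ((hasDerivAt_id u).prodMk (hasDerivAt_const u v))
    exact ((hLd (t, u, v)).hasFDerivAt.comp_hasDerivAt u h).deriv
  have h3 : ∀ t u v : ℝ, partial3 L t u v = fderiv ℝ L (t, u, v) (0, 0, 1) := by
    intro t u v
    have h : HasDerivAt (fun z : ℝ => (t, u, z)) ((0 : ℝ), (0 : ℝ), (1 : ℝ)) v :=
      (hasDerivAt_const v t).prodMk ((hasDerivAt_const v u).prodMk (hasDerivAt_id v))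
    exact ((hLd (t, u, v)).hasFDerivAt.comp_hasDerivAt v h).deriv
  let F : ℝ → ℝ → ℝ := fun ε t => L (t, y t + ε * η t, deriv y t + ε * deriv η t)
  let F' : ℝ → ℝ → ℝ := fun ε t =>
    fderiv ℝ L (t, y t + ε * η t, deriv y t + ε * deriv η t) (0, η t, deriv η t)
  have hF : ∀ ε, Continuous (F ε) := fun ε => by
    simp only [F]; fun_prop
  have hF' : Continuous (fun p : ℝ × ℝ => F' p.1 p.2) := by
    simp only [F']
    exact (hL'.comp (by fun_prop)).clm_apply (by fun_prop)
  obtain ⟨C, hC⟩ := ((isCompact_Icc (a := (-1 : ℝ)) (b := 1)).prod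
    (isCompact_uIcc (a := a) (b := b))).exists_bound_of_continuousOn hF'.continuousOn
  have key := (intervalIntegral.hasDerivAt_integral_of_dominated_loc_of_deriv_le
    (μ := MeasureTheory.volume) (F := F) (F' := F') (x₀ := (0 : ℝ)) (a := a) (b := b)
    (s := Set.Icc (-1) 1) (bound := fun _ => C)
    (Icc_mem_nhds (by norm_num) (by norm_num))
    (Filter.Eventually.of_forall fun ε => (hF ε).aestronglyMeasurable)
    ((hF 0).intervalIntegrable _ _)
    (hF'.comp (by fun_prop : Continuous fun t : ℝ => ((0 : ℝ), t))).aestronglyMeasurable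
    (Filter.Eventually.of_forall fun t ht ε hε =>
      hC (ε, t) ⟨hε, Set.uIoc_subset_uIcc ht⟩)
    intervalIntegrable_const
    (Filter.Eventually.of_forall fun t _ ε _ => by
      have h : HasDerivAt (fun z : ℝ => (t, y t + z * η t, deriv y t + z * deriv η t))
          ((0 : ℝ), η t, deriv η t) ε := by
        refine (hasDerivAt_const ε t).prodMk (HasDerivAt.prodMk ?_ ?_)
        · simpa using ((hasDerivAt_id ε).mul_const (η t)).const_add (y t)
        · simpa using ((hasDerivAt_id ε).mul_const (deriv η t)).const_add (deriv y t)
      exact (hLd (t, y t + ε * η t, deriv y t + ε * deriv η t)).hasFDerivAt.comp_hasDerivAt ε h)).2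
  simp only [varFunctional, hd]
  refine key.congr_deriv (Eq.symm ?_)
  refine intervalIntegral.integral_congr fun t _ => ?_
  have hv : ((0 : ℝ), η t, deriv η t)
      = η t • ((0 : ℝ), (1 : ℝ), (0 : ℝ)) + deriv η t • ((0 : ℝ), (0 : ℝ), (1 : ℝ)) := by
    simp
  simp only [F', h2, h3, zero_mul, add_zero]
  rw [hv, map_add, map_smul, map_smul]
  simp only [smul_eq_mul]
  ring

/-- Differentiability of `φ(ε) = J(yhat + ε·η)` at `ε = 0`, with the first
variation of the product functional `J = J₁·J₂` as its derivative. -/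
theorem firstVariation_product_real (a b : ℝ) (hab : a < b)
    (L₁ L₂ : ℝ × ℝ × ℝ → ℝ) (hL₁ : ContDiff ℝ 1 L₁) (hL₂ : ContDiff ℝ 1 L₂)
    (yhat η : ℝ → ℝ) (hyhat : ContDiff ℝ 1 yhat) (hη : ContDiff ℝ 1 η) :
    HasDerivAt
      (fun ε : ℝ =>
        varFunctional a b L₁ (fun t => yhat t + ε * η t) *
          varFunctional a b L₂ (fun t => yhat t + ε * η t))
      (varFunctional a b L₂ yhat *
        (∫ t in a..b, partial2 L₁ t (yhat t) (deriv yhat t) * η t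
          + partial3 L₁ t (yhat t) (deriv yhat t) * deriv η t) +
       varFunctional a b L₁ yhat *
        (∫ t in a..b, partial2 L₂ t (yhat t) (deriv yhat t) * η t
          + partial3 L₂ t (yhat t) (deriv yhat t) * deriv η t)) 0 := by
  have h := (hasDerivAt_varFunctional_aux a b L₁ hL₁ yhat η hyhat hη).mul
    (hasDerivAt_varFunctional_aux a b L₂ hL₂ yhat η hyhat hη)
  simp only [zero_mul, add_zero] at h
  refine h.congr_deriv ?_
  ring
end

section
/- Let a < b be real numbers, α, β ∈ ℝ, and let L₁, L₂ : ℝ × ℝ × ℝ → ℝ be continuously differentiable. If ŷ is a weak local extremizer of J(y) = J₁(y)·J₂(y) subject to y(a) = α, y(b) = β, then for every continuously differentiable η : ℝ → ℝ with η(a) = η(b) = 0 one has: J₂(ŷ)·∫_a^b (∂₂L₁(t, ŷ(t), ŷ'(t))·η(t) + ∂₃L₁(t, ŷ(t), ŷ'(t))·η'(t)) dt + J₁(ŷ)·∫_a^b (∂₂L₂(t, ŷ(t), ŷ'(t))·η(t) + ∂₃L₂(t, ŷ(t), ŷ'(t))·η'(t)) dt = 0. (This is the first-order necessary optimality condition (first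 variation equals zero) established in the proof of the paper's main theorem, in the case T = ℝ.) -/
theorem aux_hasDerivAt (a b : ℝ) (hab : a < b) (L : ℝ × ℝ × ℝ → ℝ) (hL : ContDiff ℝ 1 L)
    (y η : ℝ → ℝ) (hy : ContDiff ℝ 1 y) (hη : ContDiff ℝ 1 η) :
    HasDerivAt (fun ε : ℝ => varFunctional a b L (fun t => y t + ε * η t))
      (∫ t in a..b, partial2 L t (y t) (deriv y t) * η t
          + partial3 L t (y t) (deriv y t) * deriv η t) 0 := by
  have hyc := hy.continuous
  have hηc := hη.continuous
  have hyd : Continuous (deriv y) := hy.continuous_deriv le_rfl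
  have hηd : Continuous (deriv η) := hη.continuous_deriv le_rfl
  have hLd : Differentiable ℝ L := hL.differentiable one_ne_zero
  have hLc := hL.continuous
  have hfd : Continuous (fderiv ℝ L) := hL.continuous_fderiv one_ne_zero
  have hder : ∀ (ε t : ℝ), deriv (fun t => y t + ε * η t) t = deriv y t + ε * deriv η t := by
    intro ε t
    have h1 := (hy.differentiable one_ne_zero t).hasDerivAt
    have h2 := (hη.differentiable one_ne_zero t).hasDerivAt
    exact (h1.add (h2.const_mul ε)).deriv
  let F : ℝ → ℝ → ℝ := fun ε t => L (t, y t + ε * η t, deriv y t + ε * deriv η t)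
  let F' : ℝ → ℝ → ℝ := fun ε t =>
    fderiv ℝ L (t, y t + ε * η t, deriv y t + ε * deriv η t) (0, η t, deriv η t)
  have hF'c : Continuous (fun p : ℝ × ℝ => F' p.1 p.2) := by
    apply Continuous.clm_apply
    · apply hfd.comp
      fun_prop
    · fun_prop
  obtain ⟨C, hC⟩ := ((isCompact_Icc (a := (-1:ℝ)) (b := 1)).prod
    (isCompact_Icc (a := a) (b := b))).exists_bound_of_continuousOn hF'c.continuousOn
  have key := intervalIntegral.hasDerivAt_integral_of_dominated_loc_of_deriv_le
    (μ := MeasureTheory.volume) (a := a) (b := b) (F := F) (F' := F') (x₀ := (0:ℝ))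
    (s := Set.Icc (-1) 1) (bound := fun _ => C)
    (Icc_mem_nhds (by norm_num) (by norm_num))
    (Filter.Eventually.of_forall fun ε => by
      apply Continuous.aestronglyMeasurable
      show Continuous fun t => L (t, y t + ε * η t, deriv y t + ε * deriv η t)
      fun_prop)
    (by
      apply Continuous.intervalIntegrable
      show Continuous fun t => L (t, y t + 0 * η t, deriv y t + 0 * deriv η t)
      fun_prop)
    (by
      apply Continuous.aestronglyMeasurable
      exact hF'c.comp (by fun_prop : Continuous fun t : ℝ => ((0:ℝ), t)))
    (Filter.Eventually.of_forall fun t ht ε hε => by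
      rw [Set.uIoc_of_le hab.le] at ht
      exact hC (ε, t) ⟨hε, ht.1.le, ht.2⟩)
    (by simp)
    (Filter.Eventually.of_forall fun t ht ε hε => by
      have h1 : HasDerivAt (fun ε : ℝ => (t, y t + ε * η t, deriv y t + ε * deriv η t))
          (0, η t, deriv η t) ε := by
        refine (hasDerivAt_const ε t).prodMk (HasDerivAt.prodMk ?_ ?_)
        · simpa using ((hasDerivAt_id ε).mul_const (η t)).const_add (y t)
        · simpa using ((hasDerivAt_id ε).mul_const (deriv η t)).const_add (deriv y t)
      exact (hLd _).hasFDerivAt.comp_hasDerivAt ε h1)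
  have e1 : (fun ε : ℝ => varFunctional a b L (fun t => y t + ε * η t))
      = fun ε => ∫ t in a..b, F ε t := by
    funext ε
    simp only [varFunctional, hder, F]
  have e2 : ∀ t, partial2 L t (y t) (deriv y t) * η t
          + partial3 L t (y t) (deriv y t) * deriv η t = F' 0 t := by
    intro t
    have h2 : partial2 L t (y t) (deriv y t)
        = fderiv ℝ L (t, y t, deriv y t) (0, 1, 0) :=
      ((hLd _).hasFDerivAt.comp_hasDerivAt (y t)
        ((hasDerivAt_const (y t) t).prodMk
          ((hasDerivAt_id (y t)).prodMk (hasDerivAt_const (y t) (deriv y t))))).deriv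
    have h3 : partial3 L t (y t) (deriv y t)
        = fderiv ℝ L (t, y t, deriv y t) (0, 0, 1) :=
      ((hLd _).hasFDerivAt.comp_hasDerivAt (deriv y t)
        ((hasDerivAt_const (deriv y t) t).prodMk
          ((hasDerivAt_const (deriv y t) (y t)).prodMk (hasDerivAt_id (deriv y t))))).deriv
    have h4 : ((0:ℝ), η t, deriv η t)
        = η t • ((0:ℝ), (1:ℝ), (0:ℝ)) + deriv η t • ((0:ℝ), (0:ℝ), (1:ℝ)) := by
      simp
    simp only [F', zero_mul, add_zero]
    rw [h4, map_add, map_smul, map_smul, h2, h3, smul_eq_mul, smul_eq_mul]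
    ring
  rw [e1]
  simp only [e2]
  exact key.2

theorem aux_weakDist (a b : ℝ) (y η : ℝ → ℝ) (hy : ContDiff ℝ 1 y) (hη : ContDiff ℝ 1 η) :
    ∃ C : ℝ, 0 ≤ C ∧ ∀ ε : ℝ, weakDist a b (fun t => y t + ε * η t) y ≤ |ε| * C := by
  have hηd : Continuous (deriv η) := hη.continuous_deriv le_rfl
  have hder : ∀ (ε t : ℝ), deriv (fun t => y t + ε * η t) t = deriv y t + ε * deriv η t := by
    intro ε t
    have h1 := (hy.differentiable one_ne_zero t).hasDerivAt
    have h2 := (hη.differentiable one_ne_zero t).hasDerivAt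
    exact (h1.add (h2.const_mul ε)).deriv
  obtain ⟨C, hC⟩ := (isCompact_Icc (a := a) (b := b)).exists_bound_of_continuousOn
    hη.continuous.continuousOn
  obtain ⟨D, hD⟩ := (isCompact_Icc (a := a) (b := b)).exists_bound_of_continuousOn
    hηd.continuousOn
  refine ⟨|C| + |D|, by positivity, fun ε => ?_⟩
  rw [weakDist, mul_add]
  apply add_le_add
  · refine Real.iSup_le (fun t => Real.iSup_le (fun ht => ?_) (by positivity)) (by positivity)
    rw [add_sub_cancel_left, abs_mul]
    exact mul_le_mul_of_nonneg_left ((hC t ht).trans (le_abs_self C)) (abs_nonneg ε)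
  · refine Real.iSup_le (fun t => Real.iSup_le (fun ht => ?_) (by positivity)) (by positivity)
    rw [hder, add_sub_cancel_left, abs_mul]
    exact mul_le_mul_of_nonneg_left ((hD t ht).trans (le_abs_self D)) (abs_nonneg ε)

/-- The first-order necessary optimality condition (vanishing first variation)
for the product functional `J = J₁·J₂` in the case `T = ℝ`. -/
theorem firstVariationVanishes_product_real (a b α β : ℝ) (hab : a < b)
    (L₁ L₂ : ℝ × ℝ × ℝ → ℝ) (hL₁ : ContDiff ℝ 1 L₁) (hL₂ : ContDiff ℝ 1 L₂)
    (yhat : ℝ → ℝ)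
    (hext : IsWeakLocalExtremizer a b α β
      (fun y => varFunctional a b L₁ y * varFunctional a b L₂ y) yhat) :
    ∀ η : ℝ → ℝ, ContDiff ℝ 1 η → η a = 0 → η b = 0 →
      varFunctional a b L₂ yhat *
        (∫ t in a..b, partial2 L₁ t (yhat t) (deriv yhat t) * η t
          + partial3 L₁ t (yhat t) (deriv yhat t) * deriv η t) +
      varFunctional a b L₁ yhat *
        (∫ t in a..b, partial2 L₂ t (yhat t) (deriv yhat t) * η t
          + partial3 L₂ t (yhat t) (deriv yhat t) * deriv η t) = 0 := by
  intro η hη ha hb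
  obtain ⟨⟨hy, hya, hyb⟩, δ, hδ, hmin⟩ := hext
  obtain ⟨C, hC0, hC⟩ := aux_weakDist a b yhat η hy hη
  have d1 := aux_hasDerivAt a b hab L₁ hL₁ yhat η hy hη
  have d2 := aux_hasDerivAt a b hab L₂ hL₂ yhat η hy hη
  have hd := d1.mul d2
  have hadm : ∀ ε : ℝ, Admissible a b α β (fun t => yhat t + ε * η t) := fun ε =>
    ⟨hy.add (contDiff_const.mul hη), by simp [ha, hya], by simp [hb, hyb]⟩
  have hev : ∀ᶠ ε : ℝ in nhds 0, weakDist a b (fun t => yhat t + ε * η t) yhat < δ := by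
    have hcont : Continuous fun ε : ℝ => |ε| * C := by fun_prop
    have := hcont.tendsto 0
    simp only [abs_zero, zero_mul] at this
    filter_upwards [this.eventually (gt_mem_nhds hδ)] with ε hε
    exact (hC ε).trans_lt hε
  have hloc : IsLocalExtr ((fun ε : ℝ => varFunctional a b L₁ (fun t => yhat t + ε * η t)) *
      (fun ε : ℝ => varFunctional a b L₂ (fun t => yhat t + ε * η t))) 0 := by
    rcases hmin with h | h
    · left
      filter_upwards [hev] with ε hε
      simpa using h _ (hadm ε) hε
    · right
      filter_upwards [hev] with ε hε
      simpa using h _ (hadm ε) hε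
  have h0 := hloc.hasDerivAt_eq_zero hd
  simp only [zero_mul, add_zero] at h0
  have e1 : (fun t => yhat t) = yhat := rfl
  rw [e1] at h0
  linarith
end
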